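/- Let G = (V,E,w) be a weighted digraph, let h ≥ 1, and let p be an h-hop-dominant path from s to v (i.e., p is both h-hop shortest and 2h-hop shortest from s to v). Then for every index i with 0 ≤ i ≤ |p|, the prefix p[0,i] is an h-hop shortest path from s to p[i]: |p[0,i]| ≤ h and no path from s to p[i] with hop at most h is shorter than p[0,i]. -/

import Mathlib

/-- A path in a digraph with edge relation `E`: a nonempty list of vertices starting at `s`,
ending at `t`, with every consecutive pair an edge (vertices may repeat). -/
def IsPath {V : Type*} (E : V → V → Prop) (p : List V) (s t : V) : Prop :=
  p ≠ [] ∧ p.head? = some s ∧ p.getLast? = some t ∧ p.Chain' E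

/-- The hop of a path: its number of edges. -/
def hop {V : Type*} (p : List V) : ℕ := p.length - 1

/-- The weight of a path: the sum of the weights of its consecutive edges. -/
def pweight {V : Type*} (w : V → V → ℝ) (p : List V) : ℝ :=
  ((p.zip p.tail).map fun e => w e.1 e.2).sum

/-- `p` is an `h`-hop shortest path from `s` to `t`: it is an `s`-`t` path with `|p| ≤ h`
that is at most as long as every `s`-`t` path with hop at most `h`. -/
def IsHopShortest {V : Type*} (E : V → V → Prop) (w : V → V → ℝ) (p : List V)
    (s t : V) (h : ℕ) : Prop :=
  IsPath E p s t ∧ hop p ≤ h ∧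
    ∀ q : List V, IsPath E q s t → hop q ≤ h → pweight w p ≤ pweight w q

theorem pweight_append_cons {V : Type*} (w : V → V → ℝ) (a : List V) (x : V) (b : List V) :
    pweight w (a ++ x :: b) = pweight w (a ++ [x]) + pweight w (x :: b) := by
  induction a with
  | nil => simp [pweight]
  | cons y a ih =>
    cases a with
    | nil => simp [pweight]
    | cons z a =>
      simp only [pweight, List.cons_append, List.tail_cons, List.zip_cons_cons, List.map_cons,
        List.sum_cons] at ih ⊢
      rw [ih, add_assoc]

theorem isPath_append_cons {V : Type*} {E : V → V → Prop} {a b : List V} {x s t : V} :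
    IsPath E (a ++ x :: b) s t ↔ IsPath E (a ++ [x]) s x ∧ IsPath E (x :: b) x t := by
  have hc : (a ++ x :: b).IsChain E ↔ (a ++ [x]).IsChain E ∧ (x :: b).IsChain E :=
    List.isChain_split
  have hs : (a ++ x :: b).head? = (a ++ [x]).head? := by cases a <;> simp
  have ht : (a ++ x :: b).getLast? = (x :: b).getLast? := by
    rw [List.getLast?_append_of_ne_nil _ (List.cons_ne_nil x b)]
  unfold IsPath
  change _ ∧ _ ∧ _ ∧ List.IsChain E _ ↔
    (_ ∧ _ ∧ _ ∧ List.IsChain E _) ∧ (_ ∧ _ ∧ _ ∧ List.IsChain E _)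
  rw [hc, hs, ht]
  simp
  tauto

theorem IsPath.exists_eq_append {V : Type*} {E : V → V → Prop} {q : List V} {s t : V}
    (hq : IsPath E q s t) : ∃ a, q = a ++ [t] :=
  List.getLast?_eq_some_iff.mp hq.2.2.1

/-- A prefix of a path that is both `h`-hop and `2h`-hop shortest is `h`-hop shortest. -/
theorem IsHopShortest.of_append_cons {V : Type*} {E : V → V → Prop} {w : V → V → ℝ} {h : ℕ}
    {a b : List V} {x s v : V} (hp1 : IsHopShortest E w (a ++ x :: b) s v h)
    (hp2 : IsHopShortest E w (a ++ x :: b) s v (2 * h)) :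
    IsHopShortest E w (a ++ [x]) s x h := by
  obtain ⟨ha, hb⟩ := isPath_append_cons.mp hp1.1
  have hlen := hp1.2.1
  simp only [hop, List.length_append, List.length_cons] at hlen
  refine ⟨ha, ?_, fun q hq hqh => ?_⟩
  · simp only [hop, List.length_append, List.length_cons, List.length_nil]
    omega
  · obtain ⟨c, rfl⟩ := hq.exists_eq_append
    simp only [hop, List.length_append, List.length_cons, List.length_nil] at hqh
    have key := hp2.2.2 (c ++ x :: b) (isPath_append_cons.mpr ⟨hq, hb⟩) (by
      simp only [hop, List.length_append, List.length_cons]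
      omega)
    rw [pweight_append_cons w a, pweight_append_cons w c] at key
    linarith

/-- if `h ≥ 1` and `p` is an `h`-hop-dominant path from `s` to `v`
(i.e. both `h`-hop shortest and `2h`-hop shortest), then for every `0 ≤ i ≤ |p|`
the prefix `p[0,i]` is an `h`-hop shortest path from `s` to `p[i]`. -/
theorem stmt_4 {V : Type*} (E : V → V → Prop) (w : V → V → ℝ) (h : ℕ) (hh : 1 ≤ h)
    (p : List V) (s v : V)
    (hp1 : IsHopShortest E w p s v h) (hp2 : IsHopShortest E w p s v (2 * h))
    (i : ℕ) (hi : i ≤ hop p) :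
    IsHopShortest E w (p.take (i + 1)) s (p.getD i s) h := by
  have hlt : i < p.length := by
    have := List.length_pos_of_ne_nil hp1.1.1
    unfold hop at hi
    omega
  have hsplit : p = p.take i ++ p[i] :: p.drop (i + 1) := by
    rw [← List.drop_eq_getElem_cons hlt, List.take_append_drop]
  rw [List.getD_eq_getElem p s hlt, List.take_succ_eq_append_getElem hlt]
  rw [hsplit] at hp1 hp2
  exact hp1.of_append_cons hp2
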